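/- The boundary of a bounded, connected, simply connected open subset G of ℂ is connected. -/

import Mathlib

open Set Topology

lemma aux_const {X : Type*} [TopologicalSpace X] {S : Set X} (hS : IsPreconnected S) {h : X → ℂ}
    (hc : ContinuousOn h S) (he : ∀ x ∈ S, Complex.exp (h x) = 1) {x y : X} (hx : x ∈ S)
    (hy : y ∈ S) : h x = h y := by
  have : DiscreteTopology (AddSubgroup.zmultiples (2 * Real.pi * Complex.I) : Set ℂ) :=
    NormedSpace.discreteTopology_zmultiples _
  refine hS.constant_of_mapsTo (T := (AddSubgroup.zmultiples (2 * Real.pi * Complex.I) : Set ℂ))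
    ⟨this⟩ hc ?_ hx hy
  intro z hz
  obtain ⟨n, hn⟩ := Complex.exp_eq_one_iff.1 (he z hz)
  exact AddSubgroup.mem_zmultiples_iff.2 ⟨n, by rw [hn]; simp⟩

lemma aux_log {F : ℂ → ℂ} (hF : Continuous F) (h0 : ∀ z, F z ≠ 0) :
    ∃ g : ℂ → ℂ, Continuous g ∧ ∀ z, Complex.exp (g z) = F z := by
  have hs : IsSimplyConnected (univ : Set ℂ) := by
    have := convex_univ.contractibleSpace (univ_nonempty (α := ℂ))
    exact SimplyConnectedSpace.ofContractible (univ : Set ℂ)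
  obtain ⟨g, hg, he⟩ := Complex.exists_continuousOn_eqOn_exp_comp hs isOpen_univ
    hF.continuousOn (by rintro ⟨z, -, hz⟩; exact h0 z hz)
  exact ⟨g, continuousOn_univ.1 hg, fun z => he (mem_univ z)⟩

lemma aux_circle {g : ℂ → ℂ} (hg : Continuous g) (a : ℂ) {R : ℝ} (hR : 0 < R)
    (h : ∀ z, ‖z - a‖ = R → Complex.exp (g z) = z - a) : False := by
  have hR0 : (R : ℂ) ≠ 0 := by exact_mod_cast hR.ne'
  set p : ℝ → ℂ := fun t => a + R * Complex.exp (t * Complex.I) with hp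
  have hpc : Continuous p := by fun_prop
  have key := aux_const (S := (univ : Set ℝ)) isPreconnected_univ
    (h := fun t => g (p t) - t * Complex.I - Complex.log R)
    (by fun_prop) (fun t _ => by
      have h1 : Complex.exp (g (p t)) = p t - a := by
        apply h
        simp [hp, Complex.norm_exp_ofReal_mul_I, abs_of_pos hR]
      rw [Complex.exp_sub, Complex.exp_sub, Complex.exp_log hR0, h1]
      simp only [hp]
      have := Complex.exp_ne_zero (t * Complex.I)
      field_simp
      ring) (mem_univ (0 : ℝ)) (mem_univ (2 * Real.pi))
  have hpp : p (2 * Real.pi) = p 0 := by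
    simp [hp, Complex.exp_two_pi_mul_I]
  simp only [hpp] at key
  have : (Real.pi : ℂ) ≠ 0 := by exact_mod_cast Real.pi_ne_zero
  simp at key
  have h2 : 2 * (Real.pi : ℂ) * Complex.I = 0 := by linear_combination key
  simp [this] at h2

lemma aux_compl {G K L : Set ℂ} (hGo : IsOpen G) (hG : IsSimplyConnected G) (hK : IsClosed K)
    (hL : IsClosed L) (hd : Disjoint K L) (hKL : Gᶜ = K ∪ L) {R : ℝ}
    (hR : ∀ z : ℂ, R < ‖z‖ → z ∈ L) : K = ∅ := by
  classical
  by_contra hne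
  obtain ⟨a, ha⟩ := nonempty_iff_ne_empty.2 hne
  have hmem : ∀ z, z ∉ K → z ∉ L → z ∈ G := by
    intro z h1 h2
    by_contra h3
    have : z ∈ K ∪ L := hKL ▸ h3
    exact this.elim h1 h2
  have haG : a ∉ G := by
    have : a ∈ Gᶜ := by rw [hKL]; exact Or.inl ha
    exact this
  obtain ⟨h, hhc, hh⟩ := Complex.exists_continuousOn_eqOn_exp_comp hG hGo
    (g := fun z => z - a) (by fun_prop)
    (by rintro ⟨z, hz, hz0⟩; rw [sub_eq_zero] at hz0; exact haG (hz0 ▸ hz))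
  obtain ⟨f, hf0, hf1, -⟩ := exists_continuous_zero_one_of_isClosed hK hL hd
  set φ : ℂ → ℝ := fun z => max 0 (min 1 (3 * f z - 1)) with hφ
  have hφc : Continuous φ := by fun_prop
  set F : ℂ → ℂ := fun z => if z ∈ K then 1 else if z ∈ L then z - a else Complex.exp (φ z * h z)
    with hF
  have hFc : Continuous F := by
    rw [continuous_iff_continuousAt]
    intro z
    by_cases hz1 : f z < 1 / 3
    · have : F =ᶠ[𝓝 z] fun _ => 1 := by
        filter_upwards [(isOpen_lt f.continuous continuous_const).mem_nhds hz1] with w hw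
        have hw : f w < 1 / 3 := hw
        have hwL : w ∉ L := fun hwL => by
          have := hf1 hwL
          simp at this
          linarith
        have : φ w = 0 := by
          simp only [hφ]
          apply max_eq_left
          exact (min_le_right _ _).trans (by linarith)
        simp [hF, hwL, this]
      exact continuousAt_const.congr this.symm
    by_cases hz2 : 2 / 3 < f z
    · have : F =ᶠ[𝓝 z] fun w => w - a := by
        filter_upwards [(isOpen_lt continuous_const f.continuous).mem_nhds hz2] with w hw
        have hw : 2 / 3 < f w := hw
        have hwK : w ∉ K := fun hwK => by
          have := hf0 hwK
          simp at this
          linarith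
        have h1 : φ w = 1 := by
          simp only [hφ]
          rw [min_eq_left (by linarith)]
          simp
        by_cases hwL : w ∈ L
        · simp [hF, hwK, hwL]
        · have := hh (hmem w hwK hwL)
          simp only [Function.comp_apply] at this
          simp [hF, hwK, hwL, h1, this]
      exact (by fun_prop : ContinuousAt (fun w : ℂ => w - a) z).congr this.symm
    have hzK : z ∉ K := fun hzK => by
      have := hf0 hzK
      simp at this
      rw [this] at hz1
      norm_num at hz1
    have hzL : z ∉ L := fun hzL => by
      have := hf1 hzL
      simp at this
      rw [this] at hz2
      norm_num at hz2
    have hzG := hmem z hzK hzL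
    have : F =ᶠ[𝓝 z] fun w => Complex.exp (φ w * h w) := by
      filter_upwards [hK.isOpen_compl.mem_nhds hzK, hL.isOpen_compl.mem_nhds hzL] with w h1 h2
      have h1 : w ∉ K := h1
      have h2 : w ∉ L := h2
      simp [hF, h1, h2]
    have hha : ContinuousAt h z := hhc.continuousAt (hGo.mem_nhds hzG)
    have : ContinuousAt (fun w => Complex.exp (φ w * h w)) z := by fun_prop
    exact this.congr (by symm; assumption)
  have hF0 : ∀ z, F z ≠ 0 := by
    intro z
    simp only [hF]
    split_ifs with h1 h2
    · exact one_ne_zero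
    · rw [sub_ne_zero]
      rintro rfl
      exact h1 ha
    · exact Complex.exp_ne_zero _
  obtain ⟨g, hg, hge⟩ := aux_log hFc hF0
  refine aux_circle hg a (R := |R| + ‖a‖ + 1) (by positivity) fun z hz => ?_
  have hzL : z ∈ L := by
    apply hR
    have h1 := norm_sub_le z a
    have h2 := le_abs_self R
    linarith
  have hzK : z ∉ K := fun hzK => hd.le_bot ⟨hzK, hzL⟩
  rw [hge]
  simp [hF, hzK, hzL]

lemma aux_compl_conn {G : Set ℂ} (hGo : IsOpen G) (hG : IsSimplyConnected G)
    (hb : Bornology.IsBounded G) : IsPreconnected Gᶜ := by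
  obtain ⟨R, hR0, hR⟩ := hb.subset_closedBall_lt 0 0
  have hext : ∀ z : ℂ, R < ‖z‖ → z ∈ Gᶜ := fun z hz hzG => by
    have := hR hzG
    simp at this
    linarith
  have hpre : IsPreconnected ((Metric.closedBall (0 : ℂ) R)ᶜ) := by
    have h1 : (Metric.closedBall (0 : ℂ) R)ᶜ = Complex.exp '' {w | Real.log R < w.re} := by
      ext z
      simp only [mem_compl_iff, Metric.mem_closedBall, dist_zero_right, not_le, mem_image,
        mem_setOf_eq]
      constructor
      · intro hz
        have hz0 : z ≠ 0 := norm_pos_iff.1 (hR0.trans hz)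
        refine ⟨Complex.log z, ?_, Complex.exp_log hz0⟩
        rw [Complex.log_re]
        exact Real.log_lt_log hR0 hz
      · rintro ⟨w, hw, rfl⟩
        rw [Complex.norm_exp]
        exact (Real.log_lt_iff_lt_exp hR0).1 hw
    rw [h1]
    exact (convex_halfSpace_re_gt _).isPreconnected.image _ Complex.continuous_exp.continuousOn
  rw [isPreconnected_iff_subset_of_fully_disjoint_closed hGo.isClosed_compl]
  intro u v hu hv huv hd
  have hE : (Metric.closedBall (0 : ℂ) R)ᶜ ⊆ u ∪ v := fun z hz =>
    huv (hext z (by simpa using hz))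
  have aux : ∀ u v : Set ℂ, IsClosed u → IsClosed v → Gᶜ ⊆ u ∪ v → Disjoint u v →
      (Metric.closedBall (0 : ℂ) R)ᶜ ⊆ v → Gᶜ ⊆ v := by
    intro u v hu hv huv hd hE
    have := aux_compl (K := u ∩ Gᶜ) (L := v ∩ Gᶜ) hGo hG (hu.inter hGo.isClosed_compl)
      (hv.inter hGo.isClosed_compl) (hd.mono inter_subset_left inter_subset_left)
      (by rw [← union_inter_distrib_right]; exact (inter_eq_right.2 huv).symm) (R := R)
      (fun z hz => ⟨hE (by simpa using hz), hext z hz⟩)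
    intro z hz
    rcases huv hz with h | h
    · exact absurd (show z ∈ u ∩ Gᶜ from ⟨h, hz⟩) (by rw [this]; simp)
    · exact h
  rcases isPreconnected_iff_subset_of_disjoint_closed.1 hpre u v hu hv hE
    (by rw [hd.inter_eq, inter_empty]) with h | h
  · left; exact aux v u hv hu (by rwa [union_comm]) hd.symm h
  · right; exact aux u v hu hv huv hd h

/-- The boundary of a nonempty bounded connected simply connected open subset of ℂ
is connected. -/
theorem frontier_connected_of_simplyConnected
    (G : Set ℂ) (hGne : G.Nonempty) (hGopen : IsOpen G) (hGconn : IsConnected G)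
    (hGbdd : Bornology.IsBounded G) (hGsc : SimplyConnectedSpace G) :
    IsConnected (frontier G) := by
  classical
  have hsc : IsSimplyConnected G := hGsc
  have hQ := aux_compl_conn hGopen hsc hGbdd
  have hP : IsPreconnected (closure G) := hGconn.isPreconnected.closure
  have hfr : frontier G = closure G \ G := hGopen.frontier_eq
  refine ⟨?_, ?_⟩
  · rw [nonempty_frontier_iff]
    refine ⟨hGne, ?_⟩
    rintro rfl
    exact NormedSpace.unbounded_univ ℝ ℂ hGbdd
  rw [isPreconnected_iff_subset_of_fully_disjoint_closed isClosed_frontier]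
  intro A B hA hB hAB hd
  by_contra hcon
  push Not at hcon
  obtain ⟨⟨x, hx, hxA⟩, ⟨y, hy, hyB⟩⟩ := And.imp not_subset.1 not_subset.1 hcon
  have hxB : x ∈ B := (hAB hx).resolve_left hxA
  have hyA : y ∈ A := (hAB hy).resolve_right hyB
  obtain ⟨u, hu0, hu1, -⟩ := exists_continuous_zero_one_of_isClosed hA hB hd
  set E : ℂ → ℂ := fun z => Complex.exp (2 * Real.pi * Complex.I * u z) with hE
  have hEf : ∀ z ∈ frontier G, E z = 1 := by
    intro z hz
    rcases hAB hz with h | h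
    · have := hu0 h
      simp at this
      simp [hE, this]
    · have := hu1 h
      simp at this
      simp [hE, this]
  have hFc : Continuous (G.piecewise E (fun _ => 1)) :=
    Continuous.piecewise hEf (by fun_prop) continuous_const
  obtain ⟨g, hg, hge⟩ := aux_log hFc (by
    intro z
    by_cases hz : z ∈ G
    · simp [hz, hE]
    · simp [hz])
  rw [hfr] at hx hy
  have h1 := aux_const hQ hg.continuousOn (fun z hz => by
    have hz : z ∉ G := hz
    rw [hge]; simp [hz]) hx.2 hy.2
  have h2 := aux_const hP (h := fun z => g z - 2 * Real.pi * Complex.I * u z) (by fun_prop)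
    (fun z hz => by
      rw [Complex.exp_sub, hge]
      by_cases hzG : z ∈ G
      · rw [piecewise_eq_of_mem _ _ _ hzG]
        exact div_self (Complex.exp_ne_zero _)
      · rw [piecewise_eq_of_notMem _ _ _ hzG]
        have := hEf z (by rw [hfr]; exact ⟨hz, hzG⟩)
        simp only [hE] at this
        rw [this, div_one]) hx.1 hy.1
  have hux := hu1 hxB
  have huy := hu0 hyA
  simp at hux huy
  simp [h1, hux, huy] at h2
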